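/- Let S be a set of states, A a nonempty set of actions, T : S × A → S a deterministic transition function, and r : S × A → ℝ a bounded reward function. Let γ_0, ..., γ_D ∈ (0,1), let w ∈ ℝ^{D+1}, let η(t) := Σ_{d=0}^D w_d Φ_d(t), and let f(η)(t) := Σ_{d=0}^D (Γ w)_d Φ_d(t). Then for every state s ∈ S: V*_η(s) = sup over a ∈ A of [ (Σ_{d=0}^D w_d) · r(s, a) + V*_{f(η)}(T(s, a)) ]. -/

import Mathlib

/-- `Phi γ d t = Σ_{(a_0,...,a_d) ∈ ℕ^{d+1}, a_0+...+a_d = t} ∏_{i=0}^{d} γ_i^{a_i}`. -/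
noncomputable def Phi (γ : ℕ → ℝ) (d t : ℕ) : ℝ :=
  ∑ a ∈ Finset.Nat.antidiagonalTuple (d + 1) t, ∏ i : Fin (d + 1), γ i ^ a i

/-- `Gam γ D` is the (D+1)×(D+1) matrix with `Γ_{ij} = γ_i` if `i ≤ j`, else `0`. -/
def Gam (γ : ℕ → ℝ) (D : ℕ) : Matrix (Fin (D + 1)) (Fin (D + 1)) ℝ :=
  Matrix.of fun i j => if i ≤ j then γ i else 0

/-- Deterministic trajectory: `s_0 = s`, `s_{t+1} = T(s_t, a_t)`. -/
def traj {S A : Type*} (T : S → A → S) (s : S) (a : ℕ → A) : ℕ → S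
  | 0 => s
  | t + 1 => T (traj T s a t) (a t)

/-- Optimal value for weights `η`: sup over action sequences of `Σ_t η(t) r(s_t, a_t)`. -/
noncomputable def Vstar {S A : Type*} (T : S → A → S) (r : S → A → ℝ) (η : ℕ → ℝ) (s : S) : ℝ :=
  ⨆ a : ℕ → A, ∑' t, η t * r (traj T s a t) (a t)

open Finset in
theorem powerSeries_mk_Phi (γ : ℕ → ℝ) (d : ℕ) :
    PowerSeries.mk (Phi γ d) = ∏ i ∈ range (d + 1), PowerSeries.mk fun n => γ i ^ n := by
  induction d generalizing γ with
  | zero => ext t; simp [Phi]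
  | succ d ih =>
    rw [prod_range_succ', ← ih fun i => γ (i + 1)]
    ext t
    rw [mul_comm, PowerSeries.coeff_mul]
    simp only [PowerSeries.coeff_mk, Phi]
    rw [Finset.sum_congr rfl fun p _ => Finset.mul_sum _ _ _, Finset.sum_sigma']
    refine Finset.sum_bij' (fun a _ => ⟨(a 0, ∑ i, Fin.tail a i), Fin.tail a⟩)
      (fun p _ => Fin.cons p.1.1 p.2) ?_ ?_ ?_ ?_ ?_
    · intro a ha
      rw [Finset.Nat.mem_antidiagonalTuple, Fin.sum_univ_succ] at ha
      simpa [Finset.Nat.mem_antidiagonalTuple, Fin.tail] using ha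
    · rintro ⟨⟨i, j⟩, b⟩ hp
      simp only [Finset.mem_sigma, Finset.HasAntidiagonal.mem_antidiagonal,
        Finset.Nat.mem_antidiagonalTuple] at hp
      rw [Finset.Nat.mem_antidiagonalTuple, Fin.sum_univ_succ]
      simp [hp.1, hp.2]
    · intro a _
      exact Fin.cons_self_tail a
    · rintro ⟨⟨i, j⟩, b⟩ hp
      simp only [Finset.mem_sigma, Finset.HasAntidiagonal.mem_antidiagonal,
        Finset.Nat.mem_antidiagonalTuple] at hp
      obtain ⟨-, rfl⟩ := hp
      simp
    · intro a _
      rw [Fin.prod_univ_succ]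
      simp [Fin.tail]

theorem Phi_zero_left (γ : ℕ → ℝ) (t : ℕ) : Phi γ 0 t = γ 0 ^ t := by
  simp [Phi]

theorem Phi_zero_right (γ : ℕ → ℝ) (d : ℕ) : Phi γ d 0 = 1 := by
  simp [Phi, Finset.Nat.antidiagonalTuple_zero_right]

theorem Phi_succ_left (γ : ℕ → ℝ) (d t : ℕ) :
    Phi γ (d + 1) t = ∑ p ∈ Finset.HasAntidiagonal.antidiagonal t, Phi γ d p.1 * γ (d + 1) ^ p.2 := by
  have h := congrArg (PowerSeries.coeff t) (powerSeries_mk_Phi γ (d + 1))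
  rw [Finset.prod_range_succ, ← powerSeries_mk_Phi, PowerSeries.coeff_mul] at h
  simpa using h

theorem Phi_succ_succ (γ : ℕ → ℝ) (d t : ℕ) :
    Phi γ (d + 1) (t + 1) = Phi γ d (t + 1) + γ (d + 1) * Phi γ (d + 1) t := by
  rw [Phi_succ_left, Finset.Nat.sum_antidiagonal_succ', Phi_succ_left, Finset.mul_sum]
  simp only [pow_zero, mul_one]
  refine congrArg₂ (· + ·) rfl (Finset.sum_congr rfl fun p _ => ?_)
  ring

theorem Phi_succ_right (γ : ℕ → ℝ) (d t : ℕ) :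
    Phi γ d (t + 1) = ∑ i ∈ Finset.range (d + 1), γ i * Phi γ i t := by
  induction d with
  | zero => simp [Phi_zero_left, pow_succ']
  | succ d ih => rw [Phi_succ_succ, ih, Finset.sum_range_succ _ (d + 1)]

theorem summable_norm_Phi {γ : ℕ → ℝ} {d : ℕ} (hγ : ∀ i ≤ d, |γ i| < 1) :
    Summable fun t => ‖Phi γ d t‖ := by
  induction d with
  | zero =>
    simp only [Phi_zero_left]
    exact summable_norm_geometric_of_norm_lt_one (hγ 0 le_rfl)
  | succ d ih =>
    simp only [Phi_succ_left]
    exact summable_norm_sum_mul_antidiagonal_of_summable_norm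
      (ih fun i hi => hγ i (hi.trans d.le_succ))
      (summable_norm_geometric_of_norm_lt_one (hγ (d + 1) le_rfl))

theorem sum_mul_Phi_succ (γ : ℕ → ℝ) (D : ℕ) (w : Fin (D + 1) → ℝ) (t : ℕ) :
    ∑ d : Fin (D + 1), w d * Phi γ d (t + 1) =
      ∑ d : Fin (D + 1), ((Gam γ D).mulVec w) d * Phi γ d t := by
  have key (d : Fin (D + 1)) : Phi γ d (t + 1) =
      ∑ i : Fin (D + 1), if i ≤ d then γ i * Phi γ i t else 0 := by
    have h := Fin.sum_univ_eq_sum_range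
      (fun i => if i ≤ (d : ℕ) then γ i * Phi γ i t else 0) (D + 1)
    simp only [Fin.le_def]
    rw [h, Phi_succ_right, ← Finset.sum_filter]
    refine Finset.sum_congr ?_ fun _ _ => rfl
    ext i
    have := d.isLt
    simp only [Finset.mem_range, Finset.mem_filter]
    omega
  simp only [key, Matrix.mulVec, dotProduct, Gam, Matrix.of_apply, Finset.mul_sum,
    Finset.sum_mul]
  rw [Finset.sum_comm]
  refine Finset.sum_congr rfl fun i _ => Finset.sum_congr rfl fun d _ => ?_
  split_ifs <;> ring

theorem traj_succ' {S A : Type*} (T : S → A → S) (s : S) (a : ℕ → A) (t : ℕ) :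
    traj T s a (t + 1) = traj T (T s (a 0)) (fun n => a (n + 1)) t := by
  induction t with
  | zero => rfl
  | succ t ih => rw [traj, ih, traj]

theorem norm_weighted_reward_le {S A : Type*} {r : S → A → ℝ} {C : ℝ}
    (hC : ∀ s a, |r s a| ≤ C) (η : ℕ → ℝ) (x : ℕ → S) (a : ℕ → A) (t : ℕ) :
    ‖η t * r (x t) (a t)‖ ≤ ‖η t‖ * C := by
  rw [norm_mul]
  exact mul_le_mul_of_nonneg_left (hC _ _) (norm_nonneg _)

theorem bddAbove_returns {S A : Type*} (T : S → A → S) {r : S → A → ℝ} {C : ℝ}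
    (hC : ∀ s a, |r s a| ≤ C) {η : ℕ → ℝ} (hη : Summable fun t => ‖η t‖) (s : S) :
    BddAbove (Set.range fun a : ℕ → A => ∑' t, η t * r (traj T s a t) (a t)) := by
  refine ⟨∑' t, ‖η t‖ * C, ?_⟩
  rintro _ ⟨a, rfl⟩
  exact (Real.le_norm_self _).trans
    (tsum_of_norm_bounded (hη.mul_right C).hasSum (norm_weighted_reward_le hC η _ a))

theorem Vstar_eq_ciSup {S A : Type*} [Nonempty A] (T : S → A → S) {r : S → A → ℝ}
    (hr : ∃ C, ∀ s a, |r s a| ≤ C) {η : ℕ → ℝ} (hη : Summable fun t => ‖η t‖) (s : S) :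
    Vstar T r η s = ⨆ a : A, (η 0 * r s a + Vstar T r (fun t => η (t + 1)) (T s a)) := by
  obtain ⟨C, hC⟩ := hr
  have hη' : Summable fun t => ‖η (t + 1)‖ := (summable_nat_add_iff 1).2 hη
  have split (a : ℕ → A) : ∑' t, η t * r (traj T s a t) (a t) =
      η 0 * r s (a 0) +
        ∑' t, η (t + 1) * r (traj T (T s (a 0)) (fun n => a (n + 1)) t) (a (t + 1)) := by
    have hs : Summable fun t => η t * r (traj T s a t) (a t) :=
      Summable.of_norm_bounded (hη.mul_right C) (norm_weighted_reward_le hC η _ a)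
    rw [hs.tsum_eq_zero_add]
    simp only [traj_succ']
    rfl
  have step_le (a : A) :
      η 0 * r s a + Vstar T r (fun t => η (t + 1)) (T s a) ≤ Vstar T r η s := by
    rw [← le_sub_iff_add_le']
    refine ciSup_le fun b => ?_
    rw [le_sub_iff_add_le']
    have h := le_ciSup (bddAbove_returns T hC hη s) (fun n => Nat.casesOn n a b : ℕ → A)
    simp only [split] at h
    refine h.trans_eq ?_
    simp only [Vstar, split]
  refine le_antisymm (ciSup_le fun a => ?_) (ciSup_le step_le)
  rw [split]
  refine le_trans ?_ (le_ciSup ⟨_, Set.forall_mem_range.2 step_le⟩ (a 0))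
  exact add_le_add_right
    (le_ciSup (bddAbove_returns T hC hη' (T s (a 0))) fun n => a (n + 1)) _


/-- Proposition 3 of the appendix, deterministic dynamics. One-step Bellman
identity: `V*_η(s) = sup_{a ∈ A} [ (Σ_d w_d) r(s,a) + V*_{f(η)}(T(s,a)) ]` where
`η(t) = Σ_d w_d Φ_d(t)` and `[f(η)](t) = Σ_d (Γ w)_d Φ_d(t)`. -/
theorem stmt2 {S A : Type*} [Nonempty A] (T : S → A → S) (r : S → A → ℝ)
    (hr : ∃ C, ∀ s a, |r s a| ≤ C)
    (D : ℕ) (γ : ℕ → ℝ) (hγ : ∀ d ≤ D, 0 < γ d ∧ γ d < 1)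
    (w : Fin (D + 1) → ℝ) (s : S) :
    Vstar T r (fun t => ∑ d : Fin (D + 1), w d * Phi γ d t) s =
      ⨆ a : A,
        ((∑ d : Fin (D + 1), w d) * r s a
          + Vstar T r (fun t => ∑ d : Fin (D + 1), ((Gam γ D).mulVec w) d * Phi γ d t) (T s a)) := by
  have hη : Summable fun t => ‖∑ d : Fin (D + 1), w d * Phi γ d t‖ := by
    refine Summable.of_nonneg_of_le (fun _ => norm_nonneg _) (fun _ => norm_sum_le _ _)
      (summable_sum fun d _ => ?_)
    simp only [norm_mul]
    refine (summable_norm_Phi fun i hi => ?_).mul_left _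
    obtain ⟨h0, h1⟩ := hγ i (hi.trans (Nat.lt_succ_iff.1 d.isLt))
    rwa [abs_of_pos h0]
  rw [Vstar_eq_ciSup T hr hη]
  simp only [Phi_zero_right, mul_one, sum_mul_Phi_succ]
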